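/- arXiv:1709.08621 — 2 statements merged into one kernel-verified Lean document; each statement's English description precedes it below -/
import Mathlib

section
/- For all s > 0, K > 0, x > 0, σ_S > 0 and R ∈ ℝ, the discounted expected payoff of a European call under a log-normal terminal price satisfies ∫_ℝ e^{−R} · max(s·exp(R − σ_S²·x/2 + σ_S·√x·z) − K, 0) dγ(z) = s·Φ(d1(s,x)) − K·e^{−R}·Φ(d2(s,x)). -/
open MeasureTheory ProbabilityTheory Real

/-- The standard normal cumulative distribution function `Φ`. -/
noncomputable def stdNormalCDF (y : ℝ) : ℝ :=
  ((ProbabilityTheory.gaussianReal 0 1) (Set.Iic y)).toReal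

/-- `d1(s,x) = (log(s/K) + R + σ_S²·x/2)/(σ_S·√x)`. -/
noncomputable def d1 (s K σS R x : ℝ) : ℝ :=
  (Real.log (s / K) + R + σS ^ 2 * x / 2) / (σS * Real.sqrt x)

/-- `d2(s,x) = d1(s,x) − σ_S·√x`. -/
noncomputable def d2 (s K σS R x : ℝ) : ℝ :=
  d1 s K σS R x - σS * Real.sqrt x

/-- The standard Gaussian measure of an upper half-line, by symmetry. -/
theorem gaussianReal_real_Ici_neg (y : ℝ) :
    (gaussianReal 0 1).real (Set.Ici (-y)) = stdNormalCDF y := by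
  have h : (gaussianReal 0 1).map (fun x ↦ -x) = gaussianReal 0 1 := by
    simpa using gaussianReal_map_neg (μ := 0) (v := 1)
  rw [stdNormalCDF, ← measureReal_def]
  nth_rewrite 2 [← h]
  rw [map_measureReal_apply measurable_neg measurableSet_Iic]
  congr 1
  ext z
  simp

/-- The Cameron–Martin density turns the standard Gaussian density into a shifted one. -/
theorem gaussianPDFReal_zero_one_mul_exp (a z : ℝ) :
    gaussianPDFReal 0 1 z * exp (a * z - a ^ 2 / 2) = gaussianPDFReal a 1 z := by
  simp only [gaussianPDFReal, NNReal.coe_one, mul_assoc, ← exp_add]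
  congr 3
  ring

/-- Integral of the Cameron–Martin density over an upper half-line. -/
theorem setIntegral_Ici_exp_gaussianReal (a y : ℝ) :
    ∫ z in Set.Ici (-y), exp (a * z - a ^ 2 / 2) ∂(gaussianReal 0 1) =
      stdNormalCDF (y + a) := by
  rw [← gaussianReal_real_Ici_neg, ← integral_indicator measurableSet_Ici,
    integral_gaussianReal_eq_integral_smul one_ne_zero]
  have hshift : (gaussianReal 0 1).real (Set.Ici (-(y + a))) =
      (gaussianReal a 1).real (Set.Ici (-y)) := by
    have h := gaussianReal_map_add_const (μ := 0) (v := 1) a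
    rw [zero_add] at h
    rw [← h, map_measureReal_apply (measurable_add_const a) measurableSet_Ici]
    congr 1
    ext z
    simp only [Set.mem_Ici, Set.mem_preimage]
    constructor <;> intro _ <;> linarith
  rw [hshift, measureReal_def, gaussianReal_apply_eq_integral a one_ne_zero,
    ENNReal.toReal_ofReal (integral_nonneg fun z ↦ gaussianPDFReal_nonneg a 1 z),
    ← integral_indicator measurableSet_Ici]
  refine integral_congr_ae (.of_forall fun z ↦ ?_)
  by_cases hz : z ∈ Set.Ici (-y)
  · simp only [Set.indicator_of_mem hz, smul_eq_mul, gaussianPDFReal_zero_one_mul_exp]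
  · simp only [Set.indicator_of_notMem hz, smul_zero]

/-- The call finishes in the money exactly when the Gaussian variable is at least `-d2`. -/
theorem strike_le_iff_neg_d2_le {s K x σS : ℝ} (R z : ℝ) (hs : 0 < s) (hK : 0 < K)
    (hx : 0 < x) (hσS : 0 < σS) :
    K ≤ s * exp (R - σS ^ 2 * x / 2 + σS * √x * z) ↔ -d2 s K σS R x ≤ z := by
  have ha : 0 < σS * √x := by positivity
  have hd : σS * √x * d2 s K σS R x = log (s / K) + R - σS ^ 2 * x / 2 := by
    have hsq : (σS * √x) * (σS * √x) = σS ^ 2 * x := by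
      rw [mul_mul_mul_comm, mul_self_sqrt hx.le, sq]
    rw [d2, d1, mul_sub, mul_div_cancel₀ _ ha.ne', hsq]
    ring
  rw [← log_le_log_iff hK (by positivity), log_mul hs.ne' (exp_ne_zero _), log_exp,
    ← mul_le_mul_iff_right₀ (b := -d2 s K σS R x) ha, mul_neg, hd, log_div hs.ne' hK.ne']
  constructor <;> intro _ <;> linarith

/-- Black–Scholes formula under a log-normal terminal price:
`∫ e^{−R}·max(s·exp(R − σ_S²x/2 + σ_S√x·z) − K, 0) dγ(z) = s·Φ(d1) − K·e^{−R}·Φ(d2)`. -/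
theorem call_price_gaussian_integral
    (s K x σS R : ℝ) (hs : 0 < s) (hK : 0 < K) (hx : 0 < x) (hσS : 0 < σS) :
    ∫ z, Real.exp (-R) *
        max (s * Real.exp (R - σS ^ 2 * x / 2 + σS * Real.sqrt x * z) - K) 0
      ∂(gaussianReal 0 1) =
      s * stdNormalCDF (d1 s K σS R x) -
        K * Real.exp (-R) * stdNormalCDF (d2 s K σS R x) := by
  have hpayoff : ∀ z, exp (-R) * max (s * exp (R - σS ^ 2 * x / 2 + σS * √x * z) - K) 0 =
      (Set.Ici (-d2 s K σS R x)).indicator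
        (fun z ↦ s * exp (σS * √x * z - (σS * √x) ^ 2 / 2) - K * exp (-R)) z := by
    intro z
    by_cases hz : -d2 s K σS R x ≤ z
    · rw [Set.indicator_of_mem (Set.mem_Ici.mpr hz),
        max_eq_left (sub_nonneg.mpr ((strike_le_iff_neg_d2_le R z hs hK hx hσS).mpr hz)),
        mul_sub, mul_left_comm, ← exp_add, mul_pow, sq_sqrt hx.le, mul_comm (exp (-R)) K]
      congr 3
      ring
    · have hlt := mt (strike_le_iff_neg_d2_le R z hs hK hx hσS).mp hz
      rw [Set.indicator_of_notMem (by simpa using hz),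
        max_eq_right (by linarith [not_le.mp hlt]), mul_zero]
  have hint : Integrable (fun z ↦ s * exp (σS * √x * z - (σS * √x) ^ 2 / 2))
      (gaussianReal 0 1) := by
    simp only [exp_sub]
    exact ((integrable_exp_mul_gaussianReal _).div_const _).const_mul s
  simp only [hpayoff]
  rw [integral_indicator measurableSet_Ici,
    integral_sub hint.integrableOn (integrable_const _), integral_const_mul,
    setIntegral_Ici_exp_gaussianReal, setIntegral_const, gaussianReal_real_Ici_neg,
    smul_eq_mul, d2, sub_add_cancel]
  ring
end

section
/- Let X be a real random variable with X > 0 almost surely and let ε be a standard Gaussian random variable (mean 0, variance 1) independent of X. Define the terminal price S_T := s·exp(R − σ_S²·X/2 + σ_S·√X·ε). Then the discounted expected call payoff equals the mixture of Black–Scholes prices: E[e^{−R}·max(S_T − K, 0)] = E[ s·Φ(d1(s,X)) − K·e^{−R}·Φ(d2(s,X)) ]. -/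
open MeasureTheory ProbabilityTheory Real

lemma gaussianReal_Ici_toReal (a c : ℝ) :
    (gaussianReal a 1).real (Set.Ici c) = stdNormalCDF (a - c) := by
  have h : gaussianReal a 1 = (gaussianReal 0 1).map (fun z ↦ a - z) := by
    rw [gaussianReal_map_const_sub, sub_zero]
  rw [h, stdNormalCDF, map_measureReal_apply (by fun_prop) measurableSet_Ici, Measure.real]
  congr 2
  ext z
  simp only [Set.mem_preimage, Set.mem_Ici, Set.mem_Iic]
  constructor <;> intro _ <;> linarith

lemma setIntegral_exp_gaussianReal (a : ℝ) {t : Set ℝ} (ht : MeasurableSet t) :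
    ∫ z in t, Real.exp (a * z - a ^ 2 / 2) ∂(gaussianReal 0 1) =
      (gaussianReal a 1).real t := by
  rw [← integral_indicator_one ht, ← integral_indicator ht,
    integral_gaussianReal_eq_integral_smul one_ne_zero,
    integral_gaussianReal_eq_integral_smul one_ne_zero]
  congr 1
  ext z
  by_cases hz : z ∈ t
  · simp only [Set.indicator_of_mem hz, gaussianPDFReal_def, smul_eq_mul, Pi.one_apply, mul_one,
      mul_assoc, ← Real.exp_add]
    congr 2
    simp only [NNReal.coe_one]
    ring_nf
  · simp [hz]

lemma integrable_exp_mul_sub_gaussianReal (a : ℝ) :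
    Integrable (fun z ↦ Real.exp (a * z - a ^ 2 / 2)) (gaussianReal 0 1) := by
  simpa only [Real.exp_sub] using (integrable_exp_mul_gaussianReal a).div_const _

lemma stdNormalCDF_nonneg (y : ℝ) : 0 ≤ stdNormalCDF y := ENNReal.toReal_nonneg

lemma stdNormalCDF_le_one (y : ℝ) : stdNormalCDF y ≤ 1 := measureReal_le_one

/-- The discounted call payoff, as a function of the integrated variance `x` and the
Gaussian factor `z`. -/
noncomputable def discountedPayoff (s K σS R x z : ℝ) : ℝ :=
  Real.exp (-R) * max (s * Real.exp (R - σS ^ 2 * x / 2 + σS * Real.sqrt x * z) - K) 0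

lemma discountedPayoff_nonneg (s K σS R x z : ℝ) : 0 ≤ discountedPayoff s K σS R x z := by
  unfold discountedPayoff
  positivity

lemma measurable_discountedPayoff (s K σS R : ℝ) :
    Measurable (fun p : ℝ × ℝ ↦ discountedPayoff s K σS R p.1 p.2) := by
  unfold discountedPayoff
  fun_prop

lemma discountedPayoff_eq_indicator {s K σS R x : ℝ} (hs : 0 < s) (hK : 0 < K) (hσS : 0 < σS)
    (hx : 0 < x) :
    discountedPayoff s K σS R x = (Set.Ici (-d2 s K σS R x)).indicator (fun z ↦
      s * Real.exp (σS * Real.sqrt x * z - (σS * Real.sqrt x) ^ 2 / 2) - K * Real.exp (-R)) := by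
  have ha : 0 < σS * Real.sqrt x := mul_pos hσS (Real.sqrt_pos.2 hx)
  have hsq : (σS * Real.sqrt x) ^ 2 = σS ^ 2 * x := by rw [mul_pow, Real.sq_sqrt hx.le]
  have hd : d2 s K σS R x * (σS * Real.sqrt x) =
      Real.log s - Real.log K + R - σS ^ 2 * x / 2 := by
    rw [d2, sub_mul, d1, div_mul_cancel₀ _ ha.ne', ← sq, hsq, Real.log_div hs.ne' hK.ne']
    ring
  ext z
  have hST : s * Real.exp (R - σS ^ 2 * x / 2 + σS * Real.sqrt x * z) =
      K * Real.exp ((z + d2 s K σS R x) * (σS * Real.sqrt x)) := by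
    nth_rewrite 1 [← Real.exp_log hs]
    nth_rewrite 1 [← Real.exp_log hK]
    rw [← Real.exp_add, ← Real.exp_add, add_mul, hd]
    ring_nf
  by_cases hz : z ∈ Set.Ici (-d2 s K σS R x)
  · have hz' : 0 ≤ z + d2 s K σS R x := by
      rw [Set.mem_Ici] at hz
      linarith
    rw [Set.indicator_of_mem hz, discountedPayoff, max_eq_left, mul_sub, mul_left_comm,
      ← Real.exp_add, hsq]
    · ring_nf
    · rw [hST]
      nlinarith [Real.one_le_exp (mul_nonneg hz' ha.le)]
  · have hz' : z + d2 s K σS R x ≤ 0 := by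
      rw [Set.mem_Ici, not_le] at hz
      linarith
    rw [Set.indicator_of_notMem hz, discountedPayoff, max_eq_right, mul_zero]
    rw [hST]
    nlinarith [Real.exp_le_one_iff.2 (mul_nonpos_of_nonpos_of_nonneg hz' ha.le)]

lemma integrable_discountedPayoff {s K σS R x : ℝ} (hs : 0 < s) (hK : 0 < K) (hσS : 0 < σS)
    (hx : 0 < x) : Integrable (discountedPayoff s K σS R x) (gaussianReal 0 1) := by
  rw [discountedPayoff_eq_indicator hs hK hσS hx]
  exact (((integrable_exp_mul_sub_gaussianReal _).const_mul s).sub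
    (integrable_const _)).indicator measurableSet_Ici

/-- The Black–Scholes formula for a fixed integrated variance `x`. -/
lemma integral_discountedPayoff {s K σS R x : ℝ} (hs : 0 < s) (hK : 0 < K) (hσS : 0 < σS)
    (hx : 0 < x) :
    ∫ z, discountedPayoff s K σS R x z ∂(gaussianReal 0 1) =
      s * stdNormalCDF (d1 s K σS R x) - K * Real.exp (-R) * stdNormalCDF (d2 s K σS R x) := by
  rw [discountedPayoff_eq_indicator hs hK hσS hx, integral_indicator measurableSet_Ici,
    integral_sub ((integrable_exp_mul_sub_gaussianReal _).const_mul s).integrableOn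
      (integrable_const _), integral_const_mul, setIntegral_exp_gaussianReal _ measurableSet_Ici,
    setIntegral_const, gaussianReal_Ici_toReal, gaussianReal_Ici_toReal, smul_eq_mul, zero_sub,
    neg_neg, d2]
  ring_nf

lemma integrable_prod_discountedPayoff {s K σS R : ℝ} (hs : 0 < s) (hK : 0 < K) (hσS : 0 < σS)
    {μ : Measure ℝ} [IsFiniteMeasure μ] (hμ : ∀ᵐ x ∂μ, 0 < x) :
    Integrable (fun p : ℝ × ℝ ↦ discountedPayoff s K σS R p.1 p.2)
      (μ.prod (gaussianReal 0 1)) := by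
  have hmeas := (measurable_discountedPayoff s K σS R).aestronglyMeasurable
    (μ := μ.prod (gaussianReal 0 1))
  refine (integrable_prod_iff hmeas).2 ⟨?_, ?_⟩
  · filter_upwards [hμ] with x hx using integrable_discountedPayoff hs hK hσS hx
  · refine Integrable.of_bound hmeas.norm.integral_prod_right' s ?_
    filter_upwards [hμ] with x hx
    simp only [Real.norm_of_nonneg (discountedPayoff_nonneg _ _ _ _ _ _)]
    rw [Real.norm_of_nonneg (integral_nonneg fun z ↦ discountedPayoff_nonneg _ _ _ _ _ _),
      integral_discountedPayoff hs hK hσS hx]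
    have h₁ := mul_le_mul_of_nonneg_left (stdNormalCDF_le_one (d1 s K σS R x)) hs.le
    have h₂ := mul_nonneg (mul_pos hK (Real.exp_pos (-R))).le
      (stdNormalCDF_nonneg (d2 s K σS R x))
    linarith

/-- with `X > 0` a.s. and `ε` standard Gaussian independent of `X`, and
terminal price `S_T = s·exp(R − σ_S²X/2 + σ_S√X·ε)`, the discounted expected call payoff
is the mixture of Black–Scholes prices. -/
theorem call_price_mixture
    {Ω : Type*} [MeasurableSpace Ω] (Pr : Measure Ω) [IsProbabilityMeasure Pr]
    (X : Ω → ℝ) (hXmeas : Measurable X) (hXpos : ∀ᵐ ω ∂Pr, 0 < X ω)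
    (ε : Ω → ℝ) (hεmeas : Measurable ε)
    (hεlaw : Measure.map ε Pr = gaussianReal 0 1)
    (hindep : IndepFun X ε Pr)
    (s K σS R : ℝ) (hs : 0 < s) (hK : 0 < K) (hσS : 0 < σS)
    (ST : Ω → ℝ)
    (hST : ∀ ω, ST ω =
      s * Real.exp (R - σS ^ 2 * X ω / 2 + σS * Real.sqrt (X ω) * ε ω)) :
    ∫ ω, Real.exp (-R) * max (ST ω - K) 0 ∂Pr =
      ∫ ω, (s * stdNormalCDF (d1 s K σS R (X ω)) -
        K * Real.exp (-R) * stdNormalCDF (d2 s K σS R (X ω))) ∂Pr := by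
  have hμ : ∀ᵐ x ∂(Pr.map X), 0 < x :=
    (ae_map_iff hXmeas.aemeasurable measurableSet_Ioi).2 hXpos
  have : IsProbabilityMeasure (Pr.map X) := Measure.isProbabilityMeasure_map hXmeas.aemeasurable
  have hmeas := measurable_discountedPayoff s K σS R
  calc ∫ ω, Real.exp (-R) * max (ST ω - K) 0 ∂Pr
      = ∫ ω, discountedPayoff s K σS R (X ω) (ε ω) ∂Pr := by
        simp only [hST, discountedPayoff]
    _ = ∫ p, discountedPayoff s K σS R p.1 p.2 ∂(Pr.map fun ω ↦ (X ω, ε ω)) :=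
        (integral_map (hXmeas.prodMk hεmeas).aemeasurable hmeas.aestronglyMeasurable).symm
    _ = ∫ x, ∫ z, discountedPayoff s K σS R x z ∂(gaussianReal 0 1) ∂(Pr.map X) := by
        rw [hindep.map_prod_eq_prod_map_map hXmeas.aemeasurable hεmeas.aemeasurable, hεlaw,
          integral_prod _ (integrable_prod_discountedPayoff hs hK hσS hμ)]
    _ = ∫ ω, ∫ z, discountedPayoff s K σS R (X ω) z ∂(gaussianReal 0 1) ∂Pr :=
        integral_map hXmeas.aemeasurable hmeas.aestronglyMeasurable.integral_prod_right'
    _ = _ := by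
        refine integral_congr_ae ?_
        filter_upwards [hXpos] with ω hω using integral_discountedPayoff hs hK hσS hω
end
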